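/- arXiv:2211.04776 — 2 statements merged into one kernel-verified Lean document; each statement's English description precedes it below -/
import Mathlib

section
/- (Sufficient decrease.) Let f : H → ℝ be differentiable on U with A − f convex on U, and let r : H → ℝ be convex. Let τ > 0, θ ∈ U, and let θ⁺ ∈ U be a minimizer over U of the function θ' ↦ r(θ') + ⟨∇f(θ), θ' − θ⟩ + (1/τ) d_A(θ', θ). Then τ · [(f(θ⁺) + r(θ⁺)) − (f(θ) + r(θ))] ≤ − d_A(θ, θ⁺) + (τ − 1) · d_A(θ⁺, θ). -/
open scoped RealInnerProductSpace

/-- A linear lower bound on the increments of `φ` along a segment bounds the directional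
derivative from below. -/
theorem HasGradientAt.le_inner_of_forall_mul_le {H : Type*} [NormedAddCommGroup H]
    [InnerProductSpace ℝ H] [CompleteSpace H] {φ : H → ℝ} {g x v : H} {c : ℝ}
    (hφ : HasGradientAt φ g x)
    (hc : ∀ t : ℝ, 0 < t → t ≤ 1 → t * c ≤ φ (x + t • v) - φ x) : c ≤ ⟪g, v⟫ := by
  have hline := (hφ.hasFDerivAt.hasLineDerivAt v).tendsto_slope_zero_right
  rw [InnerProductSpace.toDual_apply_apply] at hline
  refine ge_of_tendsto hline ?_
  filter_upwards [Ioc_mem_nhdsGT (zero_lt_one (α := ℝ))] with t ht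
  rw [smul_eq_mul, ← div_eq_inv_mul, le_div_iff₀ ht.1, mul_comm]
  simpa using hc t ht.1 ht.2

/-- The value of a convex function at a point of the segment from `x` to `y`. -/
theorem ConvexOn.sub_le_mul_sub_of_segment {E : Type*} [AddCommGroup E] [Module ℝ E]
    {s : Set E} {φ : E → ℝ} (hφ : ConvexOn ℝ s φ) {x y : E} (hx : x ∈ s) (hy : y ∈ s)
    {t : ℝ} (ht0 : 0 ≤ t) (ht1 : t ≤ 1) :
    φ (x + t • (y - x)) - φ x ≤ t * (φ y - φ x) := by
  have h := hφ.2 hx hy (sub_nonneg.2 ht1) ht0 (sub_add_cancel 1 t)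
  have e : (1 - t) • x + t • y = x + t • (y - x) := by module
  rw [e, smul_eq_mul, smul_eq_mul] at h
  linarith

/-- First-order characterization of convexity: the tangent lies below the graph. -/
theorem ConvexOn.inner_gradient_le_sub {H : Type*} [NormedAddCommGroup H]
    [InnerProductSpace ℝ H] [CompleteSpace H] {s : Set H} {φ : H → ℝ} {g x y : H}
    (hconv : ConvexOn ℝ s φ) (hφ : HasGradientAt φ g x) (hx : x ∈ s) (hy : y ∈ s) :
    ⟪g, y - x⟫ ≤ φ y - φ x := by
  have hneg : HasGradientAt (fun z => -φ z) (-g) x := by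
    rw [hasGradientAt_iff_hasFDerivAt, map_neg]
    exact hφ.hasFDerivAt.neg
  have h := hneg.le_inner_of_forall_mul_le (v := y - x) (c := -(φ y - φ x))
    fun t ht0 ht1 => by
      have := hconv.sub_le_mul_sub_of_segment hx hy ht0.le ht1
      linarith
  rw [inner_neg_left] at h
  linarith

/-- Sufficient decrease for one Bregman proximal-gradient step: if `A - f` is convex on
`U` (1-relative smoothness), `r` is convex, and `θ⁺` minimizes
`θ' ↦ r θ' + ⟪∇f θ, θ' - θ⟫ + (1/τ) d_A(θ', θ)` over `U`, then
`τ (F(θ⁺) - F(θ)) ≤ - d_A(θ, θ⁺) + (τ - 1) d_A(θ⁺, θ)` where `F = f + r`. -/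
theorem statement14
    {H : Type*} [NormedAddCommGroup H] [InnerProductSpace ℝ H] [FiniteDimensional ℝ H]
    (U : Set H) (hUo : IsOpen U) (hUc : Convex ℝ U)
    (A : H → ℝ) (hAconv : ConvexOn ℝ U A)
    (gA : H → H) (hgA : ∀ θ ∈ U, HasGradientAt A (gA θ) θ)
    (dA : H → H → ℝ) (hdA : ∀ θ θ', dA θ θ' = A θ - A θ' - ⟪gA θ', θ - θ'⟫)
    (f : H → ℝ) (gf : H → H) (hgf : ∀ θ ∈ U, HasGradientAt f (gf θ) θ)
    (hrel : ConvexOn ℝ U (fun θ => A θ - f θ))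
    (r : H → ℝ) (hr : ConvexOn ℝ Set.univ r)
    (τ : ℝ) (hτ : 0 < τ)
    (θ θp : H) (hθ : θ ∈ U) (hθp : θp ∈ U)
    (hmin : ∀ θ' ∈ U,
      r θp + ⟪gf θ, θp - θ⟫ + (1/τ) * dA θp θ ≤
      r θ' + ⟪gf θ, θ' - θ⟫ + (1/τ) * dA θ' θ) :
    τ * ((f θp + r θp) - (f θ + r θ)) ≤ - dA θ θp + (τ - 1) * dA θp θ := by
  have hsmooth : f θp - f θ - ⟪gf θ, θp - θ⟫ ≤ dA θp θ := by
    have hgrad : HasGradientAt (fun z => A z - f z) (gA θ - gf θ) θ := by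
      rw [hasGradientAt_iff_hasFDerivAt, map_sub]
      exact (hgA θ hθ).hasFDerivAt.sub (hgf θ hθ).hasFDerivAt
    have h := hrel.inner_gradient_le_sub hgrad hθ hθp
    rw [inner_sub_left] at h
    rw [hdA]
    linarith
  have hopt : ⟪gA θ, θ - θp⟫ - τ * (r θ - r θp + ⟪gf θ, θ - θp⟫) ≤ ⟪gA θp, θ - θp⟫ := by
    refine (hgA θp hθp).le_inner_of_forall_mul_le fun t ht0 ht1 => ?_
    have hm := hmin _ (hUc.add_smul_sub_mem hθp hθ ⟨ht0.le, ht1⟩)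
    have hrt := hr.sub_le_mul_sub_of_segment (Set.mem_univ θp) (Set.mem_univ θ) ht0.le ht1
    have e : θp + t • (θ - θp) - θ = (θp - θ) + t • (θ - θp) := by abel
    simp only [hdA, e, inner_add_right, inner_smul_right] at hm
    have hm' := mul_le_mul_of_nonneg_left hm hτ.le
    have hrt' := mul_le_mul_of_nonneg_left hrt hτ.le
    field_simp at hm'
    linarith
  have hflip : ∀ g : H, ⟪g, θp - θ⟫ = -⟪g, θ - θp⟫ := fun g => by
    rw [← inner_neg_right, neg_sub]
  have hscaled := mul_le_mul_of_nonneg_left hsmooth hτ.le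
  have hsum : dA θ θp + dA θp θ = ⟪gA θ, θ - θp⟫ - ⟪gA θp, θ - θp⟫ := by
    rw [hdA, hdA, hflip]
    ring
  rw [hflip] at hscaled
  linarith
end

section
/- (Geometric convergence in the α = 1 case.) Assume f(θ) = A(θ) − ⟨θ, m⟩ + c on U for some m ∈ H and c ∈ ℝ, let F = f + r, assume the step-sizes satisfy τ_k ∈ [ε₀, 1] for some ε₀ ∈ (0,1], and let θ* ∈ U be a minimizer of F over U. Then: (i) for every k, d_A(θ*, θ_{k+1}) ≤ (1 − τ_{k+1}) · d_A(θ*, θ_k), and consequently d_A(θ*, θ_k) ≤ (1 − ε₀)^k · d_A(θ*, θ_0) for every k; (ii) for every k ≥ 1, F(θ_k) − F(θ*) ≤ ((1 − ε₀)^k / ε₀) · d_A(θ*, θ_0). (When A is the log-partition function of an exponential family and m = π(Γ), one has d_A(θ*, θ_k) = KL(q_{θ_k}, q_{θ*}) and F is the regularized Kullback–Leibler objective.) -/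
open scoped RealInnerProductSpace

section BregmanProximalGradient

variable {H : Type*} [NormedAddCommGroup H] [InnerProductSpace ℝ H]

lemma ConvexOn.apply_add_smul_sub_le {U : Set H} {A : H → ℝ} (hA : ConvexOn ℝ U A) {x u : H}
    (hx : x ∈ U) (hu : u ∈ U) {t : ℝ} (ht : t ∈ Set.Ioo (0 : ℝ) 1) :
    A (x + t • (u - x)) ≤ A x + t * (A u - A x) := by
  have h := hA.2 hx hu (sub_nonneg.2 ht.2.le) ht.1.le (sub_add_cancel 1 t)
  have e : (1 - t) • x + t • u = x + t • (u - x) := by module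
  rw [e, smul_eq_mul, smul_eq_mul] at h
  linarith

variable [CompleteSpace H]

/-- If the increments of `h` along the segment from `x` in direction `v` grow at least at
rate `a`, so does the directional derivative of `h` at `x`. -/
lemma HasGradientAt.le_inner_of_forall_mul_le_s19 {h : H → ℝ} {g x v : H} {a : ℝ}
    (hg : HasGradientAt h g x)
    (ha : ∀ t ∈ Set.Ioo (0 : ℝ) 1, t * a ≤ h (x + t • v) - h x) : a ≤ ⟪g, v⟫ := by
  have hd : HasDerivAt (fun t : ℝ => h (x + t • v)) ⟪g, v⟫ 0 := by
    have hline : HasDerivAt (fun t : ℝ => x + t • v) v 0 := by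
      simpa using ((hasDerivAt_id (0 : ℝ)).smul_const v).const_add x
    have hf : HasFDerivAt h (InnerProductSpace.toDual ℝ H g) (x + (0 : ℝ) • v) := by
      simpa using hg.hasFDerivAt
    exact hf.comp_hasDerivAt (0 : ℝ) hline
  refine ge_of_tendsto hd.tendsto_slope_zero_right ?_
  filter_upwards [Ioo_mem_nhdsGT (zero_lt_one' ℝ)] with t ht
  have := ha t ht
  simp only [zero_add, zero_smul, add_zero, smul_eq_mul]
  rw [inv_mul_eq_div, le_div_iff₀ ht.1]
  linarith

lemma ConvexOn.inner_gradient_le_sub_s19 {U : Set H} {A : H → ℝ} (hA : ConvexOn ℝ U A) {g x u : H}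
    (hg : HasGradientAt A g x) (hx : x ∈ U) (hu : u ∈ U) : ⟪g, u - x⟫ ≤ A u - A x := by
  have hneg : HasGradientAt (fun y => -A y) (-g) x := by
    rw [hasGradientAt_iff_hasFDerivAt, map_neg]
    exact hg.hasFDerivAt.neg
  have h := hneg.le_inner_of_forall_mul_le_s19 (v := u - x) (a := A x - A u) fun t ht => by
    linarith [hA.apply_add_smul_sub_le hx hu ht]
  rw [inner_neg_left] at h
  linarith

/-- First-order optimality condition for the sum of a convex and a differentiable function. -/
lemma ConvexOn.sub_le_inner_gradient_of_isMinOn {U : Set H} {r h : H → ℝ} (hr : ConvexOn ℝ U r)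
    {g x u : H} (hg : HasGradientAt h g x) (hx : x ∈ U) (hu : u ∈ U)
    (hmin : IsMinOn (fun y => r y + h y) U x) : r x - r u ≤ ⟪g, u - x⟫ := by
  refine hg.le_inner_of_forall_mul_le_s19 fun t ht => ?_
  have hm : r x + h x ≤ r (x + t • (u - x)) + h (x + t • (u - x)) :=
    hmin (hr.1.add_smul_sub_mem hx hu ⟨ht.1.le, ht.2.le⟩)
  linarith [hr.apply_add_smul_sub_le hx hu ht]

/-- Gradient of the smooth part of the Bregman proximal-gradient objective. -/
lemma HasGradientAt.bregmanModel {A : H → ℝ} {g x : H} (hg : HasGradientAt A g x)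
    (p q y : H) (b s : ℝ) :
    HasGradientAt (fun z => ⟪p, z - y⟫ + s * (A z - b - ⟪q, z - y⟫)) (p + s • (g - q)) x := by
  have hin : ∀ w : H, HasFDerivAt (fun z => ⟪w, z - y⟫) (InnerProductSpace.toDual ℝ H w) x :=
    fun w => (InnerProductSpace.toDual ℝ H w).hasFDerivAt.comp x ((hasFDerivAt_id x).sub_const y)
  rw [hasGradientAt_iff_hasFDerivAt]
  have e : InnerProductSpace.toDual ℝ H (p + s • (g - q)) = InnerProductSpace.toDual ℝ H p +
      s • (InnerProductSpace.toDual ℝ H g - InnerProductSpace.toDual ℝ H q) := by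
    simp
  rw [e]
  exact (hin p).add (((hg.hasFDerivAt.sub_const b).sub (hin q)).const_mul s)

end BregmanProximalGradient

/-- Geometric convergence in the `α = 1` case: if `f θ = A θ - ⟪θ, m⟫ + c` on `U`
(the KL objective), the step-sizes satisfy `τ_k ∈ [ε₀, 1]`, and `θ*` minimizes
`F = f + r` over `U`, then (i) `d_A(θ*, θ_{k+1}) ≤ (1 - τ_{k+1}) d_A(θ*, θ_k)`, hence
`d_A(θ*, θ_k) ≤ (1-ε₀)^k d_A(θ*, θ_0)`; and (ii) for `k ≥ 1`,
`F(θ_k) - F(θ*) ≤ ((1-ε₀)^k / ε₀) d_A(θ*, θ_0)`. -/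
theorem statement19
    {H : Type*} [NormedAddCommGroup H] [InnerProductSpace ℝ H] [FiniteDimensional ℝ H]
    (U : Set H) (hUo : IsOpen U) (hUc : Convex ℝ U)
    (A : H → ℝ) (hAconv : ConvexOn ℝ U A)
    (gA : H → H) (hgA : ∀ θ ∈ U, HasGradientAt A (gA θ) θ)
    (dA : H → H → ℝ) (hdA : ∀ θ θ', dA θ θ' = A θ - A θ' - ⟪gA θ', θ - θ'⟫)
    (f : H → ℝ) (gf : H → H) (hgf : ∀ θ ∈ U, HasGradientAt f (gf θ) θ)
    (r : H → ℝ) (hr : ConvexOn ℝ Set.univ r)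
    (m : H) (c : ℝ) (hf : ∀ θ ∈ U, f θ = A θ - ⟪θ, m⟫ + c)
    (ε₀ : ℝ) (hε₀ : ε₀ ∈ Set.Ioc (0:ℝ) 1)
    (τ : ℕ → ℝ) (hτ : ∀ k, τ k ∈ Set.Icc ε₀ 1)
    (θ : ℕ → H) (hθU : ∀ k, θ k ∈ U)
    (hmin : ∀ k, ∀ θ' ∈ U,
      r (θ (k+1)) + ⟪gf (θ k), θ (k+1) - θ k⟫ + (1/τ (k+1)) * dA (θ (k+1)) (θ k) ≤
      r θ' + ⟪gf (θ k), θ' - θ k⟫ + (1/τ (k+1)) * dA θ' (θ k))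
    (θs : H) (hθs : θs ∈ U)
    (hθsmin : ∀ θ' ∈ U, f θs + r θs ≤ f θ' + r θ') :
    (∀ k, dA θs (θ (k+1)) ≤ (1 - τ (k+1)) * dA θs (θ k)) ∧
    (∀ k, dA θs (θ k) ≤ (1 - ε₀) ^ k * dA θs (θ 0)) ∧
    (∀ k : ℕ, 1 ≤ k →
      (f (θ k) + r (θ k)) - (f θs + r θs) ≤ (1 - ε₀) ^ k / ε₀ * dA θs (θ 0)) := by
  have hgrad : ∀ x ∈ U, gf x = gA x - m := by
    intro x hx
    refine (hgf x hx).unique ?_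
    have h : HasGradientAt (fun y => A y - ⟪y, m⟫ + c) (gA x - m) x := by
      have hm : HasFDerivAt (fun y => ⟪y, m⟫) (InnerProductSpace.toDual ℝ H m) x := by
        simp only [real_inner_comm m]
        exact (InnerProductSpace.toDual ℝ H m).hasFDerivAt
      rw [hasGradientAt_iff_hasFDerivAt, map_sub]
      exact ((hgA x hx).hasFDerivAt.sub hm).add_const c
    exact h.congr_of_eventuallyEq (Filter.eventually_of_mem (hUo.mem_nhds hx) hf)
  have hnonneg : ∀ x ∈ U, ∀ y ∈ U, 0 ≤ dA x y := by
    intro x hx y hy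
    rw [hdA]
    linarith [hAconv.inner_gradient_le_sub_s19 (hgA y hy) hy hx]
  have hτpos : ∀ k, 0 < τ k := fun k => hε₀.1.trans_le (hτ k).1
  have hstep : ∀ k, τ (k+1) * ((f (θ (k+1)) + r (θ (k+1))) - (f θs + r θs)) ≤
      (1 - τ (k+1)) * dA θs (θ k) - dA θs (θ (k+1)) := by
    intro k
    have hopt := (hr.subset (Set.subset_univ U) hUc).sub_le_inner_gradient_of_isMinOn
      ((hgA _ (hθU (k+1))).bregmanModel (gf (θ k)) (gA (θ k)) (θ k) (A (θ k)) (1 / τ (k+1)))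
      (hθU (k+1)) hθs fun y hy => by
        have := hmin k y hy
        simp only [hdA] at this
        simp only [Set.mem_ofPred_eq]
        linarith
    rw [hgrad _ (hθU k)] at hopt
    have hscaled := mul_le_mul_of_nonneg_left hopt (hτpos (k+1)).le
    have hcancel : τ (k+1) * (1 / τ (k+1)) = 1 := mul_one_div_cancel (hτpos (k+1)).ne'
    have hprox := mul_nonneg (sub_nonneg.2 (hτ (k+1)).2) (hnonneg _ (hθU (k+1)) _ (hθU k))
    rw [hf _ (hθU (k+1)), hf _ hθs]
    simp only [hdA, inner_add_left, inner_sub_left, inner_sub_right, real_inner_smul_left,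
      real_inner_comm m] at hscaled hprox ⊢
    linear_combination hscaled + hprox + (⟪gA (θ (k+1)), θs⟫ - ⟪gA (θ k), θs⟫ -
      ⟪gA (θ (k+1)), θ (k+1)⟫ + ⟪gA (θ k), θ (k+1)⟫) * hcancel
  have hgap : ∀ k, 0 ≤ (f (θ k) + r (θ k)) - (f θs + r θs) :=
    fun k => sub_nonneg.2 (hθsmin _ (hθU k))
  have hcontract : ∀ k, dA θs (θ (k+1)) ≤ (1 - τ (k+1)) * dA θs (θ k) := fun k => by
    linarith [hstep k, mul_nonneg (hτpos (k+1)).le (hgap (k+1))]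
  have hrate : ∀ k, (1 - τ (k+1)) * dA θs (θ k) ≤ (1 - ε₀) * dA θs (θ k) := fun k =>
    mul_le_mul_of_nonneg_right (sub_le_sub_left (hτ (k+1)).1 1) (hnonneg _ hθs _ (hθU k))
  have hgeom : ∀ k, dA θs (θ k) ≤ (1 - ε₀) ^ k * dA θs (θ 0) := by
    intro k
    induction k with
    | zero => simp
    | succ k ih =>
      calc dA θs (θ (k+1)) ≤ (1 - ε₀) * dA θs (θ k) := (hcontract k).trans (hrate k)
        _ ≤ (1 - ε₀) * ((1 - ε₀) ^ k * dA θs (θ 0)) :=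
          mul_le_mul_of_nonneg_left ih (sub_nonneg.2 hε₀.2)
        _ = (1 - ε₀) ^ (k+1) * dA θs (θ 0) := by ring
  refine ⟨hcontract, hgeom, fun k hk => ?_⟩
  obtain ⟨k, rfl⟩ := Nat.exists_eq_add_of_le' hk
  rw [div_mul_eq_mul_div, le_div_iff₀ hε₀.1]
  calc ((f (θ (k+1)) + r (θ (k+1))) - (f θs + r θs)) * ε₀
      ≤ ((f (θ (k+1)) + r (θ (k+1))) - (f θs + r θs)) * τ (k+1) :=
        mul_le_mul_of_nonneg_left (hτ (k+1)).1 (hgap (k+1))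
    _ ≤ (1 - ε₀) * dA θs (θ k) := by
        linarith [hstep k, hrate k, hnonneg _ hθs _ (hθU (k+1))]
    _ ≤ (1 - ε₀) * ((1 - ε₀) ^ k * dA θs (θ 0)) :=
        mul_le_mul_of_nonneg_left (hgeom k) (sub_nonneg.2 hε₀.2)
    _ = (1 - ε₀) ^ (k+1) * dA θs (θ 0) := by ring
end
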